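/- Let L : ℝⁿ × ℝᵐ → ℝ be twice continuously differentiable and ρ-weakly convex–weakly concave, let η > max(ρ, 0), and let λ ∈ (0,1]. Then one step of the damped proximal point method on L from (x_k,y_k), namely (x_{k+1},y_{k+1}) = (1−λ)(x_k,y_k) + λ·prox_η(x_k,y_k), equals one step of gradient descent ascent on the saddle envelope L_η from (x_k,y_k) with step size s = λ/η: x_{k+1} = x_k − (λ/η)∇_x L_η(x_k,y_k) and y_{k+1} = y_k + (λ/η)∇_y L_η(x_k,y_k). -/

import Mathlib

open Filter Topology Metric
open scoped RealInnerProductSpace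

noncomputable section

abbrev Eu (n : ℕ) : Type := EuclideanSpace ℝ (Fin n)

noncomputable def gradx {n m : ℕ} (L : Eu n × Eu m → ℝ) (z : Eu n × Eu m) : Eu n :=
  gradient (fun u => L (u, z.2)) z.1

noncomputable def grady {n m : ℕ} (L : Eu n × Eu m → ℝ) (z : Eu n × Eu m) : Eu m :=
  gradient (fun v => L (z.1, v)) z.2

noncomputable def Hxx {n m : ℕ} (L : Eu n × Eu m → ℝ) (z : Eu n × Eu m) : Eu n →L[ℝ] Eu n :=
  fderiv ℝ (fun x => gradient (fun u => L (u, z.2)) x) z.1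

noncomputable def Hxy {n m : ℕ} (L : Eu n × Eu m → ℝ) (z : Eu n × Eu m) : Eu m →L[ℝ] Eu n :=
  fderiv ℝ (fun y => gradient (fun u => L (u, y)) z.1) z.2

noncomputable def Hyx {n m : ℕ} (L : Eu n × Eu m → ℝ) (z : Eu n × Eu m) : Eu n →L[ℝ] Eu m :=
  fderiv ℝ (fun x => gradient (fun v => L (x, v)) z.2) z.1

noncomputable def Hyy {n m : ℕ} (L : Eu n × Eu m → ℝ) (z : Eu n × Eu m) : Eu m →L[ℝ] Eu m :=
  fderiv ℝ (fun y => gradient (fun v => L (z.1, v)) y) z.2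

def WeaklyConvexConcave {n m : ℕ} (ρ : ℝ) (L : Eu n × Eu m → ℝ) : Prop :=
  ∀ z : Eu n × Eu m,
    (∀ v : Eu n, -ρ * ‖v‖ ^ 2 ≤ ⟪(Hxx L z) v, v⟫) ∧
    (∀ w : Eu m, ⟪(Hyy L z) w, w⟫ ≤ ρ * ‖w‖ ^ 2)

def IntDomX {n m : ℕ} (η α : ℝ) (L : Eu n × Eu m → ℝ) : Prop :=
  ∀ z : Eu n × Eu m, ∀ v : Eu n,
    α * ‖v‖ ^ 2 ≤
      ⟪(Hxx L z) v +
        (Hxy L z) ((Ring.inverse (η • (1 : Eu m →L[ℝ] Eu m) - Hyy L z)) ((Hyx L z) v)), v⟫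

def IntDomY {n m : ℕ} (η α : ℝ) (L : Eu n × Eu m → ℝ) : Prop :=
  ∀ z : Eu n × Eu m, ∀ w : Eu m,
    α * ‖w‖ ^ 2 ≤
      ⟪-((Hyy L z) w) +
        (Hyx L z) ((Ring.inverse (η • (1 : Eu n →L[ℝ] Eu n) + Hxx L z)) ((Hxy L z) w)), w⟫

noncomputable def proxObj {n m : ℕ} (η : ℝ) (L : Eu n × Eu m → ℝ) (z w : Eu n × Eu m) : ℝ :=
  L w + η / 2 * ‖w.1 - z.1‖ ^ 2 - η / 2 * ‖w.2 - z.2‖ ^ 2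

def IsProxPoint {n m : ℕ} (η : ℝ) (L : Eu n × Eu m → ℝ) (z w : Eu n × Eu m) : Prop :=
  (∀ v : Eu m, proxObj η L z (w.1, v) ≤ proxObj η L z w) ∧
  (∀ u : Eu n, proxObj η L z w ≤ proxObj η L z (u, w.2))

noncomputable def saddleEnv {n m : ℕ} (η : ℝ) (L : Eu n × Eu m → ℝ)
    (prox : Eu n × Eu m → Eu n × Eu m) (z : Eu n × Eu m) : ℝ :=
  proxObj η L z (prox z)

noncomputable def moreau {n : ℕ} (η : ℝ) (f : Eu n → ℝ) (x : Eu n) : ℝ :=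
  ⨅ u : Eu n, (f u + η / 2 * ‖u - x‖ ^ 2)

noncomputable def lyap {n m : ℕ} (η : ℝ) (L : Eu n × Eu m → ℝ) (z : Eu n × Eu m) : ℝ :=
  -(moreau η (fun v => -L (z.1, v)) z.2) - moreau η (fun u => L (u, z.2)) z.1

noncomputable def hessForm {n m : ℕ} (L : Eu n × Eu m → ℝ) (z v w : Eu n × Eu m) : ℝ :=
  ⟪(Hxx L z) v.1, w.1⟫ + ⟪(Hxy L z) v.2, w.1⟫ + ⟪(Hyx L z) v.1, w.2⟫ + ⟪(Hyy L z) v.2, w.2⟫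

section Moreau

variable {E : Type*} [NormedAddCommGroup E] [InnerProductSpace ℝ E] [CompleteSpace E]

theorem hasDerivAt_comp_line {f : E → ℝ} (hf : Differentiable ℝ f) (a d : E) (t : ℝ) :
    HasDerivAt (fun s : ℝ => f (a + s • d)) ⟪gradient f (a + t • d), d⟫ t := by
  have hline : HasDerivAt (fun s : ℝ => a + s • d) d t := by
    simpa using ((hasDerivAt_id t).smul_const d).const_add a
  have h := (hf (a + t • d)).hasGradientAt.hasFDerivAt.comp_hasDerivAt t hline
  exact h.congr_deriv (by simp)

theorem ContDiff.differentiable_gradient {f : E → ℝ} (hf : ContDiff ℝ 2 f) :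
    Differentiable ℝ (gradient f) := by
  have h : Differentiable ℝ (fderiv ℝ f) :=
    (hf.fderiv_right (m := 1) (by norm_num)).differentiable (by norm_num)
  exact (InnerProductSpace.toDual ℝ E).symm.toContinuousLinearEquiv.differentiable.comp h

/-- A minimizer of `f + η / 2 * ‖· - x‖ ^ 2` has quadratic growth with modulus `η - ρ` when
the Hessian of `f` is bounded below by `-ρ`. -/
theorem quadratic_growth_of_hessian_ge {f : E → ℝ} {ρ η : ℝ} (hf : ContDiff ℝ 2 f)
    (hess : ∀ u v, -ρ * ‖v‖ ^ 2 ≤ ⟪fderiv ℝ (gradient f) u v, v⟫) {x a : E}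
    (hmin : ∀ u, f a + η / 2 * ‖a - x‖ ^ 2 ≤ f u + η / 2 * ‖u - x‖ ^ 2) (u : E) :
    f a + η / 2 * ‖a - x‖ ^ 2 + (η - ρ) / 2 * ‖u - a‖ ^ 2 ≤ f u + η / 2 * ‖u - x‖ ^ 2 := by
  set d := u - a with hd
  have hexp (t : ℝ) : ‖a + t • d - x‖ ^ 2
      = ‖a - x‖ ^ 2 + 2 * t * ⟪a - x, d⟫ + t ^ 2 * ‖d‖ ^ 2 := by
    rw [add_sub_right_comm, norm_add_sq_real, inner_smul_right, norm_smul, mul_pow,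
      Real.norm_eq_abs, sq_abs]
    ring
  let ψ : ℝ → ℝ := fun t => f (a + t • d) + η * t * ⟪a - x, d⟫ + ρ / 2 * t ^ 2 * ‖d‖ ^ 2
  let ψ' : ℝ → ℝ := fun t => ⟪gradient f (a + t • d), d⟫ + η * ⟪a - x, d⟫ + ρ * t * ‖d‖ ^ 2
  have hψ (t : ℝ) : HasDerivAt ψ (ψ' t) t := by
    have h := ((hasDerivAt_comp_line (hf.differentiable (by norm_num)) a d t).add
      (((hasDerivAt_id t).const_mul η).mul_const ⟪a - x, d⟫)).add
      ((((hasDerivAt_id t).pow 2).const_mul (ρ / 2)).mul_const (‖d‖ ^ 2))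
    refine h.congr_deriv ?_
    simp only [ψ', id, Nat.cast_ofNat, Nat.add_one_sub_one, pow_one]
    ring
  have hψ' (t : ℝ) : HasDerivAt ψ' (⟪fderiv ℝ (gradient f) (a + t • d) d, d⟫ + ρ * ‖d‖ ^ 2) t := by
    have hline : HasDerivAt (fun s : ℝ => a + s • d) d t := by
      simpa using ((hasDerivAt_id t).smul_const d).const_add a
    have hg := (hf.differentiable_gradient (a + t • d)).hasFDerivAt.comp_hasDerivAt t hline
    have h := ((hg.inner ℝ (hasDerivAt_const t d)).add_const (η * ⟪a - x, d⟫)).add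
      (((hasDerivAt_id t).const_mul ρ).mul_const (‖d‖ ^ 2))
    exact h.congr_deriv (by simp)
  have hmono : Monotone ψ' := monotone_of_deriv_nonneg (fun t => (hψ' t).differentiableAt)
    fun t => by
      rw [(hψ' t).deriv]
      linarith [hess (a + t • d) d]
  have hzero : ψ' 0 = 0 := by
    have hloc : IsLocalMin (fun t => ψ t + (η - ρ) / 2 * ‖d‖ ^ 2 * t ^ 2) 0 := by
      refine Eventually.of_forall fun t => ?_
      have h := hmin (a + t • d)
      rw [hexp] at h
      simp only [ψ, zero_smul, add_zero]
      linarith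
    have h := (hψ 0).add (((hasDerivAt_id (0 : ℝ)).pow 2).const_mul ((η - ρ) / 2 * ‖d‖ ^ 2))
    simpa using hloc.hasDerivAt_eq_zero h
  have hle : ψ 0 ≤ ψ 1 := by
    refine monotoneOn_of_deriv_nonneg (convex_Ici 0)
      (fun t _ => (hψ t).continuousAt.continuousWithinAt)
      (fun t _ => (hψ t).differentiableAt.differentiableWithinAt) (fun t ht => ?_)
      (Set.mem_Ici.2 le_rfl) (Set.mem_Ici.2 zero_le_one) zero_le_one
    rw [interior_Ici] at ht
    rw [(hψ t).deriv, ← hzero]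
    exact hmono (le_of_lt ht)
  have h1 := hexp 1
  have hu : a + (1 : ℝ) • d = u := by simp [hd]
  simp only [ψ, hu, zero_smul, add_zero] at hle
  rw [hu] at h1
  rw [h1]
  linarith

/-- Envelope theorem for the value of a saddle point under a quadratic perturbation centred
at `x`. -/
theorem hasGradientAt_saddle_value {F : Type*} {K : E → F → ℝ} {η μ : ℝ} (hη : 0 < η)
    (hμ : 0 < μ) {p : E → E} {q : E → F} (hmax : ∀ x v, K (p x) v ≤ K (p x) (q x))
    (hgrow : ∀ x u, K (p x) (q x) + η / 2 * ‖p x - x‖ ^ 2 + μ / 2 * ‖u - p x‖ ^ 2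
      ≤ K u (q x) + η / 2 * ‖u - x‖ ^ 2) (x : E) :
    HasGradientAt (fun x => K (p x) (q x) + η / 2 * ‖p x - x‖ ^ 2) (η • (x - p x)) x := by
  have hexp (c x' : E) : ‖c - x'‖ ^ 2 - ‖c - x‖ ^ 2
      = 2 * ⟪x - c, x' - x⟫ + ‖x' - x‖ ^ 2 := by
    have : c - x' = -((x - c) + (x' - x)) := by abel
    rw [this, norm_neg, norm_add_sq_real, norm_sub_rev c x]
    ring
  have hupper (x' : E) := (hgrow x' (p x)).trans
    (add_le_add_left (hmax x (q x')) (η / 2 * ‖p x - x'‖ ^ 2))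
  have hlower (x' : E) := (hgrow x (p x')).trans
    (add_le_add_left (hmax x' (q x)) (η / 2 * ‖p x' - x‖ ^ 2))
  have hinner (x' : E) : |⟪p x' - p x, x' - x⟫| ≤ ‖p x' - p x‖ * ‖x' - x‖ :=
    abs_real_inner_le_norm _ _
  have hsplit (x' : E) : ⟪x - p x', x' - x⟫
      = ⟪x - p x, x' - x⟫ - ⟪p x' - p x, x' - x⟫ := by
    rw [← inner_sub_left]
    congr 1
    abel
  have hlip (x' : E) : ‖p x' - p x‖ ≤ η / μ * ‖x' - x‖ := by
    have h1 := hupper x'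
    have h2 := hlower x'
    have h3 := hexp (p x) x'
    have h4 := hexp (p x') x'
    have h5 := (abs_le.1 (hinner x')).2
    rw [hsplit] at h4
    rw [norm_sub_rev (p x) (p x')] at h1
    have h6 : μ * ‖p x' - p x‖ ^ 2 ≤ η * ⟪p x' - p x, x' - x⟫ := by
      linear_combination h1 + h2 + η / 2 * h3 - η / 2 * h4
    have h7 : μ * ‖p x' - p x‖ ^ 2 ≤ η * (‖p x' - p x‖ * ‖x' - x‖) :=
      h6.trans (mul_le_mul_of_nonneg_left h5 hη.le)
    rw [div_mul_eq_mul_div, le_div_iff₀ hμ]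
    rcases (norm_nonneg (p x' - p x)).eq_or_lt with h0 | h0
    · rw [← h0]
      simp only [zero_mul]
      positivity
    · refine le_of_mul_le_mul_left ?_ h0
      linarith
  rw [hasGradientAt_iff_isLittleO]
  refine Asymptotics.IsBigO.trans_isLittleO (g := fun x' => ‖x' - x‖ ^ 2) ?_ ?_
  · refine Asymptotics.IsBigO.of_bound (η / 2 + η * (η / μ)) (Eventually.of_forall fun x' => ?_)
    have h1 := hupper x'
    have h2 := hlower x'
    have h3 := hexp (p x) x'
    have h4 := hexp (p x') x'
    rw [hsplit] at h4
    have h5 := (abs_le.1 (hinner x')).2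
    have h6 := mul_le_mul_of_nonneg_right (hlip x') (norm_nonneg (x' - x))
    have h7 := mul_le_mul_of_nonneg_left (h5.trans h6) hη.le
    have h8 : 0 ≤ μ / 2 * ‖p x' - p x‖ ^ 2 := by positivity
    have h9 : 0 ≤ η * ‖x' - x‖ ^ 2 := by positivity
    have h10 : 0 ≤ η * (η / μ) * ‖x' - x‖ ^ 2 := by positivity
    rw [norm_sub_rev (p x) (p x')] at h1
    rw [real_inner_smul_left, Real.norm_eq_abs, Real.norm_eq_abs, abs_of_nonneg (sq_nonneg ‖x' - x‖),
      abs_le]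
    constructor
    · linear_combination h2 + h8 + h7 + h9 - η / 2 * h4
    · linear_combination h1 + h8 + h10 + η / 2 * h3
  · have h : (fun x' => ‖x' - x‖) =o[𝓝 x] fun _ => (1 : ℝ) := by
      rw [Asymptotics.isLittleO_one_iff]
      have : ContinuousAt (fun x' => ‖x' - x‖) x := by fun_prop
      simpa [ContinuousAt] using this
    have h' := (Asymptotics.isBigO_refl (fun x' => ‖x' - x‖) (𝓝 x)).mul_isLittleO h
    simpa [sq] using h'.norm_right

theorem gradient_fun_neg (f : E → ℝ) :
    gradient (fun x => -f x) = fun x => -gradient f x := by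
  ext1 x
  simp [gradient, fderiv_fun_neg]

end Moreau

section SaddleEnvelope

variable {n m : ℕ} {L : Eu n × Eu m → ℝ} {ρ η : ℝ} {prox : Eu n × Eu m → Eu n × Eu m}

theorem gradx_saddleEnv (hL : ContDiff ℝ 2 L) (hweak : WeaklyConvexConcave ρ L)
    (hρ : ρ < η) (hη : 0 < η) (hprox : ∀ z, IsProxPoint η L z (prox z)) (z : Eu n × Eu m) :
    gradx (saddleEnv η L prox) z = η • (z.1 - (prox z).1) := by
  have h := hasGradientAt_saddle_value (K := fun u v => L (u, v) - η / 2 * ‖v - z.2‖ ^ 2)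
    (p := fun x => (prox (x, z.2)).1) (q := fun x => (prox (x, z.2)).2) hη (sub_pos.2 hρ)
    (fun x v => by
      have := (hprox (x, z.2)).1 v
      simp only [proxObj] at this
      linarith)
    (fun x u => by
      have := quadratic_growth_of_hessian_ge (f := fun u => L (u, (prox (x, z.2)).2))
        (ρ := ρ) (η := η) (x := x) (a := (prox (x, z.2)).1)
        (hL.comp (contDiff_id.prodMk contDiff_const))
        (fun u v => (hweak (u, (prox (x, z.2)).2)).1 v)
        (fun u => by
          have := (hprox (x, z.2)).2 u
          simp only [proxObj] at this
          linarith) u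
      linarith) z.1
  rw [gradx, ← h.gradient]
  congr 1
  ext x
  simp only [saddleEnv, proxObj]
  ring

theorem grady_saddleEnv (hL : ContDiff ℝ 2 L) (hweak : WeaklyConvexConcave ρ L)
    (hρ : ρ < η) (hη : 0 < η) (hprox : ∀ z, IsProxPoint η L z (prox z)) (z : Eu n × Eu m) :
    grady (saddleEnv η L prox) z = η • ((prox z).2 - z.2) := by
  have h := hasGradientAt_saddle_value (K := fun v u => -(L (u, v) + η / 2 * ‖u - z.1‖ ^ 2))
    (p := fun y => (prox (z.1, y)).2) (q := fun y => (prox (z.1, y)).1) hη (sub_pos.2 hρ)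
    (fun y u => by
      have := (hprox (z.1, y)).2 u
      simp only [proxObj] at this
      linarith)
    (fun y v => by
      have := quadratic_growth_of_hessian_ge (f := fun v => -L ((prox (z.1, y)).1, v))
        (ρ := ρ) (η := η) (x := y) (a := (prox (z.1, y)).2)
        (hL.comp (contDiff_const.prodMk contDiff_id)).neg
        (fun v w => by
          have := (hweak ((prox (z.1, y)).1, v)).2 w
          rw [gradient_fun_neg, fderiv_fun_neg, neg_apply, inner_neg_left]
          simp only [Hyy] at this
          linarith)
        (fun v => by
          have := (hprox (z.1, y)).1 v
          simp only [proxObj] at this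
          linarith) v
      linarith) z.2
  have heq : (fun v => saddleEnv η L prox (z.1, v)) = fun y =>
      -(-(L ((prox (z.1, y)).1, (prox (z.1, y)).2) + η / 2 * ‖(prox (z.1, y)).1 - z.1‖ ^ 2)
        + η / 2 * ‖(prox (z.1, y)).2 - y‖ ^ 2) := by
    ext y
    simp only [saddleEnv, proxObj]
    ring
  rw [grady, heq, gradient_fun_neg]
  simp only [h.gradient]
  rw [← smul_neg, neg_sub]

end SaddleEnvelope

/-- one step of the damped proximal point method on L equals one
step of gradient descent ascent on the saddle envelope with step size λ/η. -/
theorem statement5 {n m : ℕ}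
    (L : Eu n × Eu m → ℝ) (ρ η lam : ℝ)
    (hL : ContDiff ℝ 2 L)
    (hweak : WeaklyConvexConcave ρ L)
    (hη : max ρ 0 < η)
    (hlam0 : 0 < lam) (hlam1 : lam ≤ 1)
    (prox : Eu n × Eu m → Eu n × Eu m)
    (hprox : ∀ z, IsProxPoint η L z (prox z))
    (hprox_uniq : ∀ z w, IsProxPoint η L z w → w = prox z) :
    ∀ z : Eu n × Eu m,
      ((1 - lam) • z + lam • prox z).1 =
          z.1 - (lam / η) • gradx (saddleEnv η L prox) z ∧
      ((1 - lam) • z + lam • prox z).2 =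
          z.2 + (lam / η) • grady (saddleEnv η L prox) z := by
  obtain ⟨hρ, hη0⟩ := max_lt_iff.1 hη
  intro z
  rw [gradx_saddleEnv hL hweak hρ hη0 hprox, grady_saddleEnv hL hweak hρ hη0 hprox,
    smul_smul, smul_smul, div_mul_cancel₀ _ hη0.ne']
  simp only [Prod.fst_add, Prod.snd_add, Prod.smul_fst, Prod.smul_snd]
  constructor <;> module

end
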